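/- Let f : A → B be a surjective quandle homomorphism. Then there exist a quandle C and surjective quandle homomorphisms p : A → C and m : C → B with f = m ∘ p, such that Eq(p) ⊆ ≈_A and Eq(m) ∩ ≈_C = Δ_C. (Concretely, C can be taken to be the quotient quandle A/(Eq(f) ∩ ≈_A).) -/

import Mathlib

/- Conventions: we use Mathlib's `Quandle`, in which the translation by `b` is
`Rack.act' b : a ↦ b ◃ a` (the mirror of the paper's right-action convention
`ρ_b : a ↦ a ◃ b`).  Accordingly, a *trivial* quandle is one with `x ◃ y = y`. -/

open Quandles

/-- The subgroup `Inn(A)` of inner automorphisms of a quandle `A`: the subgroup of the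
permutation group of `A` generated by the translations. -/
def Inn (A : Type*) [Quandle A] : Subgroup (Equiv.Perm A) :=
  Subgroup.closure (Set.range fun b : A => (Rack.act' b : Equiv.Perm A))

/-- A quandle homomorphism: a map preserving `◃` (and hence `◃⁻¹`). -/
def IsQndHom {A B : Type*} [Quandle A] [Quandle B] (f : A → B) : Prop :=
  ∀ a a' : A, f (a ◃ a') = f a ◃ f a'

/-- A congruence on a quandle: an equivalence relation compatible with `◃` and `◃⁻¹`. -/
def IsQndCongr {A : Type*} [Quandle A] (R : A → A → Prop) : Prop :=
  Equivalence R ∧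
    (∀ a b a' b' : A, R a b → R a' b' → R (a ◃ a') (b ◃ b')) ∧
    (∀ a b a' b' : A, R a b → R a' b' → R (a ◃⁻¹ a') (b ◃⁻¹ b'))

/-- The component relation (connectedness) setoid of a quandle: `a ≈ b` iff some inner
automorphism sends `a` to `b`.  Its quotient is `π₀(A)`. -/
def compSetoid (A : Type*) [Quandle A] : Setoid A where
  r a b := ∃ φ ∈ Inn A, φ a = b
  iseqv := by
    constructor
    · exact fun a => ⟨1, one_mem _, rfl⟩
    · rintro a b ⟨φ, hφ, rfl⟩
      exact ⟨φ⁻¹, inv_mem hφ, by simp⟩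
    · rintro a b c ⟨φ, hφ, rfl⟩ ⟨ψ, hψ, rfl⟩
      exact ⟨ψ * φ, mul_mem hψ hφ, by simp⟩

universe u v

/-- The congruence `Eq(f) ∩ ≈_A`. -/
def kerComp {A : Type u} {B : Type v} [Quandle A] (f : A → B) : Setoid A :=
  Setoid.ker f ⊓ compSetoid A

theorem comp_act {A : Type u} [Quandle A] (b a : A) : (compSetoid A).r a (b ◃ a) :=
  ⟨Rack.act' b, Subgroup.subset_closure ⟨b, rfl⟩, rfl⟩

theorem comp_invAct {A : Type u} [Quandle A] (b a : A) : (compSetoid A).r a (b ◃⁻¹ a) :=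
  ⟨(Rack.act' b)⁻¹, inv_mem (Subgroup.subset_closure ⟨b, rfl⟩), rfl⟩

theorem hom_invAct {A : Type u} {B : Type v} [Quandle A] [Quandle B] {f : A → B}
    (hhom : IsQndHom f) (a a' : A) : f (a ◃⁻¹ a') = f a ◃⁻¹ f a' := by
  rw [← Rack.left_cancel (f a), ← hhom, Rack.act_invAct_eq, Rack.act_invAct_eq]

theorem kerComp_act {A : Type u} {B : Type v} [Quandle A] [Quandle B] {f : A → B}
    (hhom : IsQndHom f) (a b : A) (h : (kerComp f).r a b) (a' b' : A)
    (h' : (kerComp f).r a' b') : (kerComp f).r (a ◃ a') (b ◃ b') := by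
  have h1 : f a = f b := h.1
  have h2 : f a' = f b' := h'.1
  refine ⟨?_, ?_⟩
  · change f _ = f _
    rw [hhom, hhom, h1, h2]
  · exact (compSetoid A).trans ((compSetoid A).symm (comp_act a a'))
      ((compSetoid A).trans h'.2 (comp_act b b'))

theorem kerComp_invAct {A : Type u} {B : Type v} [Quandle A] [Quandle B] {f : A → B}
    (hhom : IsQndHom f) (a b : A) (h : (kerComp f).r a b) (a' b' : A)
    (h' : (kerComp f).r a' b') : (kerComp f).r (a ◃⁻¹ a') (b ◃⁻¹ b') := by
  have h1 : f a = f b := h.1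
  have h2 : f a' = f b' := h'.1
  refine ⟨?_, ?_⟩
  · change f _ = f _
    rw [hom_invAct hhom, hom_invAct hhom, h1, h2]
  · exact (compSetoid A).trans ((compSetoid A).symm (comp_invAct a a'))
      ((compSetoid A).trans h'.2 (comp_invAct b b'))

/-- The quotient quandle `A / (Eq(f) ∩ ≈_A)`. -/
@[reducible]
def quotQuandle {A : Type u} {B : Type v} [Quandle A] [Quandle B] {f : A → B}
    (hhom : IsQndHom f) : Quandle (Quotient (kerComp f)) where
  act := Quotient.map₂ (fun a b => a ◃ b)
    (fun a b h a' b' h' => kerComp_act hhom a b h a' b' h')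
  invAct := Quotient.map₂ (fun a b => a ◃⁻¹ b)
    (fun a b h a' b' h' => kerComp_invAct hhom a b h a' b' h')
  self_distrib := by
    intro x y z
    induction x using Quotient.inductionOn
    induction y using Quotient.inductionOn
    induction z using Quotient.inductionOn
    exact congrArg (Quotient.mk _) Shelf.self_distrib
  left_inv := by
    intro x y
    induction x using Quotient.inductionOn
    induction y using Quotient.inductionOn
    exact congrArg (Quotient.mk _) (Rack.invAct_act_eq _ _)
  right_inv := by
    intro x y
    induction x using Quotient.inductionOn
    induction y using Quotient.inductionOn
    exact congrArg (Quotient.mk _) (Rack.act_invAct_eq _ _)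
  fix := by
    intro x
    induction x using Quotient.inductionOn
    exact congrArg (Quotient.mk _) Quandle.fix

/-- Inner automorphisms lift along surjective homomorphisms. -/
theorem inn_lift {A : Type u} {C : Type v} [Quandle A] [Quandle C] {p : A → C}
    (hp : IsQndHom p) (hs : Function.Surjective p) (ψ : Equiv.Perm C) (hψ : ψ ∈ Inn C) :
    ∃ φ ∈ Inn A, ∀ a, ψ (p a) = p (φ a) := by
  unfold Inn at hψ
  induction hψ using Subgroup.closure_induction with
  | mem x hx =>
    obtain ⟨c, rfl⟩ := hx
    obtain ⟨b, rfl⟩ := hs c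
    exact ⟨Rack.act' b, Subgroup.subset_closure ⟨b, rfl⟩, fun a => (hp b a).symm⟩
  | one => exact ⟨1, one_mem _, fun a => rfl⟩
  | mul x y _ _ hx hy =>
    obtain ⟨φ, h, e⟩ := hx
    obtain ⟨φ', h', e'⟩ := hy
    exact ⟨φ * φ', mul_mem h h', fun a => by simp [e, e']⟩
  | inv x _ hx =>
    obtain ⟨φ, h, e⟩ := hx
    exact ⟨φ⁻¹, inv_mem h, fun a => by rw [Equiv.Perm.inv_eq_iff_eq, e]; simp⟩

/-- Every surjective quandle homomorphism `f : A → B` factors as `f = m ∘ p` with `p`, `m`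
surjective homomorphisms, `Eq(p) ⊆ ≈_A` and `Eq(m) ∩ ≈_C = Δ_C`. -/
theorem stmt10 {A : Type u} {B : Type v} [Quandle A] [Quandle B] (f : A → B)
    (hf : Function.Surjective f) (hhom : IsQndHom f) :
    ∃ (C : Type u) (_ : Quandle C) (p : A → C) (m : C → B),
      IsQndHom p ∧ IsQndHom m ∧ Function.Surjective p ∧ Function.Surjective m ∧
      (∀ a : A, m (p a) = f a) ∧
      (∀ a a' : A, p a = p a' → ∃ φ ∈ Inn A, φ a = a') ∧
      (∀ c c' : C, m c = m c' → (∃ ψ ∈ Inn C, ψ c = c') → c = c') := by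
  letI : Quandle (Quotient (kerComp f)) := quotQuandle hhom
  have hp : IsQndHom (Quotient.mk (kerComp f)) := fun a b => rfl
  have hs : Function.Surjective (Quotient.mk (kerComp f)) := Quotient.mk_surjective
  refine ⟨Quotient (kerComp f), quotQuandle hhom, Quotient.mk _,
    Quotient.lift f (fun a b h => h.1), hp, ?_, hs, ?_, fun a => rfl, ?_, ?_⟩
  · intro x y
    induction x using Quotient.inductionOn
    induction y using Quotient.inductionOn
    exact hhom _ _
  · intro b
    obtain ⟨a, rfl⟩ := hf b
    exact ⟨Quotient.mk _ a, rfl⟩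
  · intro a a' h
    exact (Quotient.exact h).2
  · intro c c' hm ⟨ψ, hψ, e⟩
    obtain ⟨a, rfl⟩ := hs c
    obtain ⟨a', rfl⟩ := hs c'
    obtain ⟨φ, hφ, hl⟩ := inn_lift hp hs ψ hψ
    rw [hl] at e
    exact Quotient.sound ⟨hm, (compSetoid A).trans ⟨φ, hφ, rfl⟩ (Quotient.exact e).2⟩
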